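/- Let q = 2^m with m even, m ≥ 4. Define B^0_{σ_{7,3},q+1} as the set of 7-subsets B of U_{q+1} such that σ_{5,2}(B \ {u_i, u_j}) = 0 for some pair of distinct elements u_i, u_j ∈ B. Then (U_{q+1}, B^0_{σ_{7,3},q+1}) is a 3-(q+1, 7, 7(q−5)(q−4)/4) design. -/

import Mathlib

open Finset

attribute [local instance] Classical.propDecidable

/-- The `l`-th elementary symmetric polynomial evaluated on a finite set `B`. -/
noncomputable def esym {F : Type*} [CommRing F] (B : Finset F) (l : ℕ) : F :=
  ∑ s ∈ B.powersetCard l, ∏ x ∈ s, x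

/-- The set of `n`-th roots of unity. -/
def rootsSet (F : Type*) [Monoid F] (n : ℕ) : Set F := {u | u ^ n = 1}


theorem card_blocks_mul {α : Type*} {U : Finset α} {P : Finset (Finset α)} {k j n : ℕ}
    (hP : ∀ D ∈ P, D ⊆ U ∧ #D = k)
    (h : ∀ T ⊆ U, #T = j + 1 → #{D ∈ P | T ⊆ D} = n) {S : Finset α} (hS : S ⊆ U) (hj : #S = j) :
    (#U - j) * n = (k - j) * #{D ∈ P | S ⊆ D} := by
  have key := sum_card_bipartiteAbove_eq_sum_card_bipartiteBelow
    (s := U \ S) (t := {D ∈ P | S ⊆ D}) (fun x D => x ∈ D)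
  have h1 : ∀ x ∈ U \ S, #(bipartiteAbove (fun x D => x ∈ D) {D ∈ P | S ⊆ D} x) = n := by
    intro x hx
    rw [mem_sdiff] at hx
    rw [← h (insert x S) (insert_subset hx.1 hS) (by rw [card_insert_of_notMem hx.2, hj])]
    congr 1
    ext D
    simp only [mem_bipartiteAbove, mem_filter, insert_subset_iff]
    tauto
  have h2 : ∀ D ∈ ({D ∈ P | S ⊆ D} : Finset (Finset α)),
      #(bipartiteBelow (fun x D => x ∈ D) (U \ S) D) = k - j := by
    intro D hD
    rw [mem_filter] at hD
    rw [← (hP D hD.1).2, ← hj, ← card_sdiff_of_subset hD.2]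
    congr 1
    ext x
    simp only [mem_bipartiteBelow, mem_sdiff]
    have := (hP D hD.1).1
    exact ⟨fun hx => ⟨hx.2, hx.1.2⟩, fun hx => ⟨⟨this hx.1, hx.2⟩, hx.1⟩⟩
  rw [sum_congr rfl h1, sum_congr rfl h2, sum_const, sum_const, card_sdiff_of_subset hS, hj] at key
  simpa [mul_comm] using key

theorem sum_choose_card_inter {α : Type*} (P : Finset (Finset α)) (E : Finset α) (j : ℕ) :
    ∑ D ∈ P, (#(E ∩ D)).choose j = ∑ S ∈ E.powersetCard j, #{D ∈ P | S ⊆ D} := by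
  have key := sum_card_bipartiteAbove_eq_sum_card_bipartiteBelow
    (s := E.powersetCard j) (t := P) (fun S D => S ⊆ D)
  refine Eq.trans (sum_congr rfl fun D _ => ?_) key.symm
  rw [← card_powersetCard]
  congr 1
  ext S
  simp only [mem_bipartiteBelow, mem_powersetCard, subset_inter_iff]
  tauto

theorem card_powersetCard_superset {α : Type*} {U W : Finset α} (hW : W ⊆ U) {k : ℕ}
    (hk : #W ≤ k) :
    #{B ∈ U.powersetCard k | W ⊆ B} = (#U - #W).choose (k - #W) := by
  rw [← card_sdiff_of_subset hW, ← card_powersetCard]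
  refine card_nbij' (· \ W) (· ∪ W) ?_ ?_ ?_ ?_
  · intro B hB
    simp only [mem_coe, mem_filter, mem_powersetCard] at hB
    simp only [mem_coe, mem_powersetCard]
    exact ⟨sdiff_subset_sdiff hB.1.1 subset_rfl, by rw [card_sdiff_of_subset hB.2, hB.1.2]⟩
  · intro T hT
    simp only [mem_coe, mem_powersetCard, subset_sdiff] at hT
    simp only [mem_coe, mem_filter, mem_powersetCard]
    refine ⟨⟨union_subset hT.1.1 hW, ?_⟩, subset_union_right⟩
    rw [card_union_of_disjoint hT.1.2, hT.2]
    omega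
  · intro B hB
    simp only [mem_coe, mem_filter, mem_powersetCard] at hB
    exact sdiff_union_of_subset hB.2
  · intro T hT
    simp only [mem_coe, mem_powersetCard, subset_sdiff] at hT
    exact union_sdiff_cancel_right hT.1.2

theorem eq_of_steiner {α : Type*} {U : Finset α} {P : Finset (Finset α)}
    (hP : ∀ D ∈ P, D ⊆ U ∧ #D = 5)
    (h : ∀ T ⊆ U, #T = 3 → #{D ∈ P | T ⊆ D} = 1) {D D' B : Finset α} (hD : D ∈ P) (hD' : D' ∈ P)
    (hB : #B = 7) (hDB : D ⊆ B) (hDB' : D' ⊆ B) : D = D' := by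
  have h1 := card_union_add_card_inter D D'
  have h2 := card_le_card (union_subset hDB hDB')
  rw [(hP D hD).2, (hP D' hD').2] at h1
  obtain ⟨T, hT, hT3⟩ := exists_subset_card_eq (show 3 ≤ #(D ∩ D') by omega)
  rw [subset_inter_iff] at hT
  exact card_le_one.1 (h T (hT.1.trans (hP D hD).1) hT3).le D (by simp [hD, hT.1]) D'
    (by simp [hD', hT.2])

/-- In a Steiner system `S(3, 5, v)`, the number of `7`-sets of points that contain a block and
three given points. -/
theorem card_seven_superset_block {α : Type*} {U : Finset α} {P : Finset (Finset α)}
    (hP : ∀ D ∈ P, D ⊆ U ∧ #D = 5)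
    (h : ∀ T ⊆ U, #T = 3 → #{D ∈ P | T ⊆ D} = 1) {E : Finset α} (hE : E ⊆ U) (hE3 : #E = 3) :
    4 * #{B ∈ U.powersetCard 7 | (∃ D ∈ P, D ⊆ B) ∧ E ⊆ B} = 7 * (#U - 6) * (#U - 5) := by
  have h3 : ∀ S ∈ E.powersetCard 3, #{D ∈ P | S ⊆ D} = 1 := fun S hS => by
    rw [mem_powersetCard] at hS
    exact h S (hS.1.trans hE) hS.2
  have hU : 5 ≤ #U := by
    obtain ⟨D, hD⟩ := card_pos.1 (by rw [h E hE hE3]; exact one_pos)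
    rw [mem_filter] at hD
    exact (hP D hD.1).2 ▸ card_le_card (hP D hD.1).1
  have h2 : ∀ S ⊆ U, #S = 2 → #{D ∈ P | S ⊆ D} = (#U - 2) / 3 := fun S hS hS2 => by
    have := card_blocks_mul hP h hS hS2
    omega
  have hdiv : 3 * ((#U - 2) / 3) = #U - 2 := by
    obtain ⟨S, hS, hS2⟩ := exists_subset_card_eq (show 2 ≤ #U by omega)
    have := card_blocks_mul hP h hS hS2
    omega
  have h1 : ∀ S ⊆ U, #S = 1 → 4 * #{D ∈ P | S ⊆ D} = (#U - 1) * ((#U - 2) / 3) :=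
    fun S hS hS1 => (card_blocks_mul hP h2 hS hS1).symm
  have e1 : 4 * ∑ D ∈ P, (#(E ∩ D)).choose 1 = 3 * ((#U - 1) * ((#U - 2) / 3)) := by
    rw [sum_choose_card_inter, mul_sum]
    rw [sum_congr rfl fun S hS => h1 S ((mem_powersetCard.1 hS).1.trans hE) (mem_powersetCard.1 hS).2]
    simp [hE3]
  have e2 : ∑ D ∈ P, (#(E ∩ D)).choose 2 = 3 * ((#U - 2) / 3) := by
    rw [sum_choose_card_inter]
    rw [sum_congr rfl fun S hS => h2 S ((mem_powersetCard.1 hS).1.trans hE) (mem_powersetCard.1 hS).2]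
    simp [hE3]
  have e3 : ∑ D ∈ P, (#(E ∩ D)).choose 3 = 1 := by
    rw [sum_choose_card_inter, sum_congr rfl h3]
    simp [hE3]
  have hbU : {B ∈ U.powersetCard 7 | (∃ D ∈ P, D ⊆ B) ∧ E ⊆ B} =
      P.biUnion fun D => {B ∈ U.powersetCard 7 | D ∪ E ⊆ B} := by
    ext B
    simp only [mem_filter, mem_biUnion, union_subset_iff]
    tauto
  have hdisj : (P : Set (Finset α)).PairwiseDisjoint
      fun D => {B ∈ U.powersetCard 7 | D ∪ E ⊆ B} := by
    intro D hD D' hD' hne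
    refine disjoint_left.2 fun B hB hB' => hne ?_
    simp only [mem_filter, mem_powersetCard, union_subset_iff] at hB hB'
    exact eq_of_steiner hP h hD hD' hB.1.2 hB.2.1 hB'.2.1
  have hterm : ∀ D ∈ P, (#{B ∈ U.powersetCard 7 | D ∪ E ⊆ B} : ℚ) =
      ((#(E ∩ D)).choose 1 : ℕ) + (#U - 8 : ℚ) * ((#(E ∩ D)).choose 2 : ℕ) +
        ((#U - 5) * (#U - 6) / 2 - 3 * (#U - 8) - 3 : ℚ) * ((#(E ∩ D)).choose 3 : ℕ) := by
    intro D hD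
    have hc := card_union_add_card_inter D E
    have hDE : D ∪ E ⊆ U := union_subset (hP D hD).1 hE
    have hcU := card_le_card hDE
    have hi : #(E ∩ D) ≤ 3 := hE3 ▸ card_le_card inter_subset_left
    rw [(hP D hD).2, hE3, inter_comm] at hc
    rcases Nat.eq_zero_or_pos #(E ∩ D) with h0 | hpos
    · have : #{B ∈ U.powersetCard 7 | D ∪ E ⊆ B} = 0 := by
        rw [card_eq_zero, filter_eq_empty_iff]
        intro B hB hsub
        have := card_le_card hsub
        rw [(mem_powersetCard.1 hB).2] at this
        omega
      rw [this, h0]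
      simp
    · rw [card_powersetCard_superset hDE (by omega), show #(D ∪ E) = 8 - #(E ∩ D) by omega]
      have hcases : #(E ∩ D) = 1 ∨ #(E ∩ D) = 2 ∨ #(E ∩ D) = 3 := by omega
      rcases hcases with hh | hh | hh
      · simp [hh, Nat.choose]
      · have : 6 ≤ #U := by omega
        simp [hh, Nat.cast_sub this]
        ring
      · simp only [hh]
        norm_num [Nat.cast_choose_two, Nat.cast_sub hU, Nat.choose]
        ring
  rw [hbU, card_biUnion fun D hD D' hD' hne => hdisj hD hD' hne]
  have hsum : ((∑ D ∈ P, #{B ∈ U.powersetCard 7 | D ∪ E ⊆ B} : ℕ) : ℚ) =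
      (∑ D ∈ P, (#(E ∩ D)).choose 1 : ℕ) + (#U - 8 : ℚ) * (∑ D ∈ P, (#(E ∩ D)).choose 2 : ℕ) +
        ((#U - 5) * (#U - 6) / 2 - 3 * (#U - 8) - 3 : ℚ) *
          (∑ D ∈ P, (#(E ∩ D)).choose 3 : ℕ) := by
    push_cast
    rw [sum_congr rfl hterm, sum_add_distrib, sum_add_distrib, mul_sum, mul_sum]
  rw [e2, e3, hdiv, Nat.cast_sub (by omega)] at hsum
  rw [mul_left_comm, hdiv] at e1
  have e1' : (4 : ℚ) * (∑ D ∈ P, (#(E ∩ D)).choose 1 : ℕ) = (#U - 1) * (#U - 2) := by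
    rw [← Nat.cast_ofNat, ← Nat.cast_mul, e1, Nat.cast_mul, Nat.cast_sub (by omega),
      Nat.cast_sub (by omega)]
    simp
  rcases hU.eq_or_lt with h5 | h6
  · rw [← h5] at hsum e1' ⊢
    have : ((∑ D ∈ P, #{B ∈ U.powersetCard 7 | D ∪ E ⊆ B} : ℕ) : ℚ) = 0 := by
      push_cast at hsum e1' ⊢
      linarith
    rw [Nat.cast_eq_zero.1 this]
  · have : 6 ≤ #U := h6
    have : (4 : ℚ) * (∑ D ∈ P, #{B ∈ U.powersetCard 7 | D ∪ E ⊆ B} : ℕ) =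
        7 * (#U - 6 : ℕ) * (#U - 5 : ℕ) := by
      rw [Nat.cast_sub this, Nat.cast_sub hU, hsum]
      push_cast at e1' ⊢
      linear_combination e1'
    exact_mod_cast this

theorem exists_block_of_three {F : Type*} [Field F] [CharP F 2] (φ : F →+* F)
    (hφ : ∀ x, φ (φ x) = x) {w : F} (hw : w ^ 2 + w + 1 = 0) (hφw : φ w = w) {a b c : F}
    (ha : a * φ a = 1) (hb : b * φ b = 1) (hc : c * φ c = 1) (hab : a ≠ b) (hac : a ≠ c)
    (hbc : b ≠ c) :
    ∃ d, d * φ d = 1 ∧ d ≠ a ∧ d ≠ b ∧ d ≠ c ∧ b + w * a + w ^ 2 * c ≠ 0 ∧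
      d * (b + w * a + w ^ 2 * c) = w ^ 2 * (a * b) + a * c + w * (b * c) := by
  have h2 : (2 : F) = 0 := CharTwo.two_eq_zero
  have hw0 : w ≠ 0 := by rintro rfl; simp at hw
  have hab' : a + b ≠ 0 := fun h => hab (CharTwo.add_eq_zero.1 h)
  have hac' : a + c ≠ 0 := fun h => hac (CharTwo.add_eq_zero.1 h)
  have hbc' : b + c ≠ 0 := fun h => hbc (CharTwo.add_eq_zero.1 h)
  have hφN : a * b * c * φ (b + w * a + w ^ 2 * c) =
      w ^ 2 * (a * b) + a * c + w * (b * c) := by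
    simp only [map_add, map_mul, map_pow, hφw]
    linear_combination a * c * hb + w * b * c * ha + w ^ 2 * a * b * hc
  have hN : b + w * a + w ^ 2 * c ≠ 0 := by
    intro h0
    have : w ^ 2 * (a * b) + a * c + w * (b * c) = 0 := by rw [← hφN, h0]; simp
    have : w * ((a + b) * (a + c)) = 0 := by grind
    simp_all
  obtain ⟨d, hd⟩ : ∃ d, d * (b + w * a + w ^ 2 * c) =
      w ^ 2 * (a * b) + a * c + w * (b * c) := ⟨_, div_mul_cancel₀ _ hN⟩
  refine ⟨d, ?_, ?_, ?_, ?_, hN, hd⟩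
  · have hN' : φ (b + w * a + w ^ 2 * c) ≠ 0 := (map_ne_zero φ).2 hN
    have h1 := hd.trans hφN.symm
    have h3 := congrArg φ h1
    simp only [map_mul, hφ] at h3
    generalize b + w * a + w ^ 2 * c = N at *
    apply mul_right_cancel₀ (mul_ne_zero hN hN')
    have : a * φ a * (b * φ b) * (c * φ c) = 1 := by rw [ha, hb, hc]; simp
    linear_combination φ d * φ N * h1 + a * b * c * φ N * h3 + N * φ N * this
  · rintro rfl
    have : w * ((d + b) * (d + c)) = 0 := by grind
    simp_all
  · rintro rfl
    have : (a + d) * (d + c) = 0 := by grind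
    simp_all
  · rintro rfl
    have : w ^ 2 * ((a + d) * (b + d)) = 0 := by grind
    simp_all

theorem mul_ne_zero_of_three {F : Type*} [Field F] [CharP F 2] {a b c : F} (hab : a ≠ b)
    (hac : a ≠ c) (hbc : b ≠ c) : (a + b) * (b + c) * (c + a) ≠ 0 := by
  simp [CharTwo.add_eq_zero, hab, hbc, hac.symm]

/-- Applying an involution that inverts all five elements to `σ₂ = 0` gives `σ₃ = 0`. -/
theorem sum_mul_prod_of_block {F : Type*} [Field F] [CharP F 2] (φ : F →+* F) {a b c d e : F}
    (ha : a * φ a = 1) (hb : b * φ b = 1) (hc : c * φ c = 1) (hd : d * φ d = 1) (he : e * φ e = 1)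
    (h : a * b + b * c + c * a + (a + b + c) * (d + e) + d * e = 0) :
    (d + e) * (a ^ 2 + b ^ 2 + c ^ 2 + a * b + b * c + c * a) = (a + b) * (b + c) * (c + a) := by
  have h2 : (2 : F) = 0 := CharTwo.two_eq_zero
  have h3 := congrArg φ h
  simp only [map_add, map_mul, map_zero] at h3
  rw [eq_inv_of_mul_eq_one_right ha, eq_inv_of_mul_eq_one_right hb, eq_inv_of_mul_eq_one_right hc,
    eq_inv_of_mul_eq_one_right hd, eq_inv_of_mul_eq_one_right he] at h3
  have ha0 := left_ne_zero_of_mul_eq_one ha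
  have hb0 := left_ne_zero_of_mul_eq_one hb
  have hc0 := left_ne_zero_of_mul_eq_one hc
  have hd0 := left_ne_zero_of_mul_eq_one hd
  have he0 := left_ne_zero_of_mul_eq_one he
  have h4 : a * b * c + (a * b + b * c + c * a) * (d + e) + (a + b + c) * (d * e) = 0 := by
    field_simp at h3
    linear_combination h3
  grind

theorem pair_of_block {F : Type*} [Field F] [CharP F 2] {w : F} (hw : w ^ 2 + w + 1 = 0)
    {a b c d e : F} (hab : a ≠ b) (hac : a ≠ c) (hbc : b ≠ c)
    (hN : b + w * a + w ^ 2 * c ≠ 0) (hN' : b + w ^ 2 * a + w * c ≠ 0)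
    (hd : d * (b + w * a + w ^ 2 * c) = w ^ 2 * (a * b) + a * c + w * (b * c))
    (he : e * (b + w ^ 2 * a + w * c) = w * (a * b) + a * c + w ^ 2 * (b * c)) :
    d ≠ e ∧ a * b + b * c + c * a + (a + b + c) * (d + e) + d * e = 0 := by
  have h2 : (2 : F) = 0 := CharTwo.two_eq_zero
  have h3 := mul_ne_zero_of_three hab hac hbc
  have hw3 : w ^ 3 = 1 := by linear_combination (w - 1) * hw
  have hs : (d + e) * ((b + w * a + w ^ 2 * c) * (b + w ^ 2 * a + w * c)) =
      (a + b) * (b + c) * (c + a) := by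
    have : (d + e) * ((b + w * a + w ^ 2 * c) * (b + w ^ 2 * a + w * c)) =
      (w ^ 2 * (a * b) + a * c + w * (b * c)) * (b + w ^ 2 * a + w * c) +
      (w * (a * b) + a * c + w ^ 2 * (b * c)) * (b + w * a + w ^ 2 * c) := by
      rw [← hd, ← he]; ring
    rw [this]
    clear hd he this hN hN' h3
    grind
  have hp : (d * e) * ((b + w * a + w ^ 2 * c) * (b + w ^ 2 * a + w * c)) =
      (w ^ 2 * (a * b) + a * c + w * (b * c)) * (w * (a * b) + a * c + w ^ 2 * (b * c)) := by
    rw [← hd, ← he]; ring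
  constructor
  · rintro rfl
    rw [← hs] at h3
    exact h3 (by rw [CharTwo.add_self_eq_zero, zero_mul])
  · refine (mul_eq_zero.1 ?_).resolve_right (mul_ne_zero hN hN')
    have : (a * b + b * c + c * a + (a + b + c) * (d + e) + d * e) *
      ((b + w * a + w ^ 2 * c) * (b + w ^ 2 * a + w * c)) =
      (a * b + b * c + c * a) * ((b + w * a + w ^ 2 * c) * (b + w ^ 2 * a + w * c)) +
      (a + b + c) * ((a + b) * (b + c) * (c + a)) +
      (w ^ 2 * (a * b) + a * c + w * (b * c)) * (w * (a * b) + a * c + w ^ 2 * (b * c)) := by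
      rw [← hs, ← hp]; ring
    rw [this]
    clear hs hp hd he this hN hN' h3
    grind

theorem esym_zero {F : Type*} [CommRing F] (s : Finset F) : esym s 0 = 1 := by simp [esym]

theorem esym_empty_succ {F : Type*} [CommRing F] (l : ℕ) : esym (∅ : Finset F) (l + 1) = 0 := by
  rw [esym, powersetCard_eq_empty.2 (by simp), sum_empty]

theorem esym_insert {F : Type*} [CommRing F] {a : F} {s : Finset F} (ha : a ∉ s) (l : ℕ) :
    esym (insert a s) (l + 1) = a * esym s l + esym s (l + 1) := by
  have hmem : ∀ t ∈ s.powersetCard l, a ∉ t := fun t ht h => ha ((mem_powersetCard.1 ht).1 h)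
  unfold esym
  rw [powersetCard_succ_insert ha, sum_union, sum_image, mul_sum, add_comm]
  · congr 1
    exact sum_congr rfl fun t ht => prod_insert (hmem t ht)
  · intro t ht t' ht' h
    rw [← erase_insert (hmem t ht), ← erase_insert (hmem t' ht')]
    exact congrArg (fun r => r.erase a) h
  · refine disjoint_left.2 fun t ht ht' => ?_
    obtain ⟨r, -, rfl⟩ := mem_image.1 ht'
    exact ha ((mem_powersetCard.1 ht).1 (mem_insert_self a r))

theorem esym_three_union_pair {F : Type*} [CommRing F] {a b c d e : F} (hab : a ≠ b) (hac : a ≠ c)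
    (hbc : b ≠ c) (hde : d ≠ e) (h : Disjoint ({a, b, c} : Finset F) {d, e}) :
    esym ({a, b, c} ∪ {d, e}) 2 =
      a * b + b * c + c * a + (a + b + c) * (d + e) + d * e := by
  simp only [disjoint_insert_left, disjoint_singleton_left, mem_insert, mem_singleton,
    not_or] at h
  rw [insert_union, insert_union, singleton_union, ← insert_empty_eq e]
  repeat rw [esym_insert (by simp; tauto)]
  repeat rw [esym_insert (by simp; try tauto)]
  simp only [esym_zero, esym_empty_succ]
  ring

theorem card_blocks_of_three {F : Type*} [Field F] [CharP F 2] (φ : F →+* F)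
    (hφ : ∀ x, φ (φ x) = x) {w : F} (hw : w ^ 2 + w + 1 = 0) (hφw : φ w = w) {U : Finset F}
    (hU : ∀ x, x ∈ U ↔ x * φ x = 1) {T : Finset F} (hT : T ⊆ U) (hT3 : #T = 3) :
    #{D ∈ {D ∈ U.powersetCard 5 | esym D 2 = 0} | T ⊆ D} = 1 := by
  obtain ⟨a, b, c, hab, hac, hbc, rfl⟩ := card_eq_three.1 hT3
  have hTU := hT
  simp only [insert_subset_iff, singleton_subset_iff, hU] at hT
  obtain ⟨ha, hb, hc⟩ := hT
  have hw4 : w ^ 4 = w := by linear_combination (w ^ 2 - w) * hw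
  obtain ⟨d, hd, hda, hdb, hdc, hN, hdN⟩ :=
    exists_block_of_three φ hφ hw hφw ha hb hc hab hac hbc
  obtain ⟨e, he, hea, heb, hec, hN', heN⟩ :=
    exists_block_of_three φ hφ (w := w ^ 2) (by linear_combination hw4 + hw)
      (by rw [map_pow, hφw]) ha hb hc hab hac hbc
  rw [← pow_mul, hw4] at hN' heN
  obtain ⟨hde, h0⟩ := pair_of_block hw hab hac hbc hN hN' hdN heN
  have hdisj : Disjoint ({a, b, c} : Finset F) {d, e} := by
    simp only [disjoint_insert_left, disjoint_singleton_left, mem_insert, mem_singleton]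
    tauto
  rw [card_eq_one]
  refine ⟨{a, b, c} ∪ {d, e}, ?_⟩
  ext D
  simp only [mem_filter, mem_powersetCard, mem_singleton]
  constructor
  · rintro ⟨⟨⟨hDU, hD5⟩, hD0⟩, hTD⟩
    have hcard := card_sdiff_of_subset hTD
    rw [hT3, hD5] at hcard
    obtain ⟨d', e', hde', hDT⟩ := card_eq_two.1 hcard
    have hD : D = {a, b, c} ∪ {d', e'} := by rw [← hDT, union_sdiff_of_subset hTD]
    have hdisj' : Disjoint ({a, b, c} : Finset F) {d', e'} := hDT ▸ disjoint_sdiff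
    rw [hD, esym_three_union_pair hab hac hbc hde' hdisj'] at hD0
    have hd' : d' * φ d' = 1 := (hU d').1 (hDU (by simp [hD]))
    have he' : e' * φ e' = 1 := (hU e').1 (hDU (by simp [hD]))
    have h1 := sum_mul_prod_of_block φ ha hb hc hd he h0
    have h2 := sum_mul_prod_of_block φ ha hb hc hd' he' hD0
    have hne : a ^ 2 + b ^ 2 + c ^ 2 + a * b + b * c + c * a ≠ 0 := fun h => by
      rw [h, mul_zero] at h1
      exact mul_ne_zero_of_three hab hac hbc h1.symm
    have hs : d' + e' = d + e := mul_right_cancel₀ hne (h2.trans h1.symm)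
    have hp : d' * e' = d * e := by linear_combination hD0 - h0 - (a + b + c) * hs
    have hq : (d' - d) * (d' - e) = 0 := by linear_combination d' * hs - hp
    rw [hD]
    congr 1
    rcases mul_eq_zero.1 hq with h | h
    · rw [sub_eq_zero] at h
      subst h
      rw [add_left_cancel hs]
    · rw [sub_eq_zero] at h
      subst h
      rw [add_comm d] at hs
      rw [add_left_cancel hs, pair_comm]
  · rintro rfl
    refine ⟨⟨⟨union_subset hTU ?_, ?_⟩, ?_⟩, subset_union_left⟩
    · simp [insert_subset_iff, hU, hd, he]
    · rw [card_union_of_disjoint hdisj, hT3, card_pair hde]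
    · rw [esym_three_union_pair hab hac hbc hde hdisj, h0]

theorem exists_erase_erase_iff {α : Type*} {B : Finset α} {k : ℕ} (hB : #B = k + 2)
    (p : Finset α → Prop) :
    (∃ u ∈ B, ∃ v ∈ B, u ≠ v ∧ p ((B.erase u).erase v)) ↔ ∃ D ⊆ B, #D = k ∧ p D := by
  constructor
  · rintro ⟨u, hu, v, hv, huv, hp⟩
    refine ⟨_, (erase_subset _ _).trans (erase_subset _ _), ?_, hp⟩
    rw [card_erase_of_mem (mem_erase.2 ⟨huv.symm, hv⟩), card_erase_of_mem hu, hB]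
    rfl
  · rintro ⟨D, hD, hDk, hp⟩
    have hcard := card_sdiff_of_subset hD
    rw [hB, hDk, Nat.add_sub_cancel_left] at hcard
    obtain ⟨u, v, huv, h⟩ := card_eq_two.1 hcard
    have hu : u ∈ B \ D := by simp [h]
    have hv : v ∈ B \ D := by simp [h]
    refine ⟨u, (mem_sdiff.1 hu).1, v, (mem_sdiff.1 hv).1, huv, ?_⟩
    convert hp
    rw [← Finset.sdiff_sdiff_eq_self hD, h]
    ext x
    simp
    tauto

theorem exists_isPrimitiveRoot_of_dvd {F : Type*} [Field F] [Finite F] {n : ℕ}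
    (hn : n ∣ Nat.card F - 1) : ∃ z : F, IsPrimitiveRoot z n := by
  obtain ⟨g, hg⟩ := IsCyclic.exists_ofOrder_eq_natCard (α := Fˣ)
  obtain ⟨k, hk⟩ := hn
  have hg' := IsPrimitiveRoot.orderOf g
  rw [hg, Nat.card_units, hk, mul_comm] at hg'
  have hpos : 0 < k * n := by
    rw [mul_comm, ← hk, ← Nat.card_units]
    exact Nat.card_pos
  exact ⟨_, (hg'.pow hpos rfl).map_of_injective (f := Units.coeHom F) Units.val_injective⟩

theorem ncard_seven_superset_card_three {F : Type*} [Field F] [CharP F 2] [Finite F] {m : ℕ}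
    (hm : 4 ≤ m) (heven : Even m) (hcard : Nat.card F = 2 ^ (2 * m)) {E : Finset F}
    (hEU : ↑E ⊆ rootsSet F (2 ^ m + 1)) (hE : E.card = 3) :
    {B : Finset F | ↑B ⊆ rootsSet F (2 ^ m + 1) ∧ B.card = 7 ∧
      (∃ u ∈ B, ∃ v ∈ B, u ≠ v ∧ esym ((B.erase u).erase v) 2 = 0) ∧ E ⊆ B}.ncard =
        7 * (2 ^ m - 5) * (2 ^ m - 4) / 4 := by
  have hfac : 2 ^ (2 * m) - 1 = (2 ^ m + 1) * (2 ^ m - 1) := by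
    rw [mul_comm 2 m, pow_mul, ← Nat.sq_sub_sq, one_pow]
  have h3 : 3 ∣ 2 ^ m - 1 := by
    obtain ⟨k, rfl⟩ := heven
    rw [← two_mul, pow_mul]
    simpa using Nat.sub_dvd_pow_sub_pow 4 1 k
  obtain ⟨w, hw⟩ := exists_isPrimitiveRoot_of_dvd (F := F) (n := 3)
    (by rw [hcard, hfac]; exact h3.mul_left _)
  obtain ⟨z, hz⟩ := exists_isPrimitiveRoot_of_dvd (F := F) (n := 2 ^ m + 1)
    (by rw [hcard, hfac]; exact dvd_mul_right _ _)
  have hw1 : w ^ 2 + w + 1 = 0 := by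
    have := hw.geom_sum_eq_zero (by norm_num)
    simp only [sum_range_succ, range_zero, sum_empty] at this
    linear_combination this
  let φ : F →+* F := iterateFrobenius F 2 m
  have hφ_apply : ∀ x, φ x = x ^ 2 ^ m := fun x => iterateFrobenius_def 2 m x
  have hφ : ∀ x, φ (φ x) = x := fun x => by
    let _ := Fintype.ofFinite F
    rw [hφ_apply, hφ_apply, ← pow_mul, ← pow_add, ← two_mul, ← hcard, Nat.card_eq_fintype_card,
      FiniteField.pow_card]
  have hφw : φ w = w := by
    obtain ⟨k, hk⟩ := h3
    rw [hφ_apply, show 2 ^ m = 3 * k + 1 by have := Nat.one_le_two_pow (n := m); omega, pow_succ,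
      pow_mul, hw.pow_eq_one, one_pow, one_mul]
  let U : Finset F := Polynomial.nthRootsFinset (2 ^ m + 1) (1 : F)
  have hmem : ∀ x, x ∈ U ↔ x ^ (2 ^ m + 1) = 1 := fun x =>
    Polynomial.mem_nthRootsFinset (by positivity) 1
  have hUcard : #U = 2 ^ m + 1 := hz.card_nthRootsFinset
  have hU : ∀ x, x ∈ U ↔ x * φ x = 1 := fun x => by rw [hmem, hφ_apply, pow_succ']
  have hsub : ∀ B : Finset F, ↑B ⊆ rootsSet F (2 ^ m + 1) ↔ B ⊆ U := fun B =>
    ⟨fun h x hx => (hmem x).2 (h hx), fun h x hx => (hmem x).1 (h hx)⟩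
  have key := card_seven_superset_block (U := U) (P := {D ∈ U.powersetCard 5 | esym D 2 = 0})
    (fun D hD => mem_powersetCard.1 (mem_filter.1 hD).1)
    (fun T hT hT3 => card_blocks_of_three φ hφ hw1 hφw hU hT hT3) ((hsub E).1 hEU) hE
  have hset : {B : Finset F | ↑B ⊆ rootsSet F (2 ^ m + 1) ∧ B.card = 7 ∧
      (∃ u ∈ B, ∃ v ∈ B, u ≠ v ∧ esym ((B.erase u).erase v) 2 = 0) ∧ E ⊆ B} =
      ↑({B ∈ U.powersetCard 7 |
        (∃ D ∈ {D ∈ U.powersetCard 5 | esym D 2 = 0}, D ⊆ B) ∧ E ⊆ B} : Finset (Finset F)) := by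
    ext B
    simp only [Set.mem_ofPred_eq, mem_coe, mem_filter, mem_powersetCard, hsub]
    rw [← and_assoc, ← and_assoc, ← and_assoc]
    refine and_congr_left fun _ => and_congr_right fun hB => ?_
    rw [exists_erase_erase_iff hB.2 fun D => esym D 2 = 0]
    refine exists_congr fun D => ?_
    have : D ⊆ B → D ⊆ U := fun h => h.trans hB.1
    tauto
  rw [hset, Set.ncard_coe_finset]
  rw [hUcard] at key
  rw [show 2 ^ m - 5 = 2 ^ m + 1 - 6 by omega, show 2 ^ m - 4 = 2 ^ m + 1 - 5 by omega, ← key,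
    Nat.mul_div_cancel_left _ four_pos]
  congr!

theorem stmt18 (m : ℕ) (hm : 4 ≤ m) (heven : Even m)
    (E : Finset (GaloisField 2 (2 * m)))
    (hEU : ↑E ⊆ rootsSet (GaloisField 2 (2 * m)) (2 ^ m + 1))
    (hE : E.card = 3) :
    {B : Finset (GaloisField 2 (2 * m)) |
        ↑B ⊆ rootsSet (GaloisField 2 (2 * m)) (2 ^ m + 1) ∧ B.card = 7 ∧
          (∃ u ∈ B, ∃ v ∈ B, u ≠ v ∧ esym ((B.erase u).erase v) 2 = 0) ∧
            E ⊆ B}.ncard = 7 * (2 ^ m - 5) * (2 ^ m - 4) / 4 := by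
  exact ncard_seven_superset_card_three hm heven (GaloisField.card 2 (2 * m) (by omega)) hEU hE
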